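/- arXiv:1011.4782 — 3 statements merged into one kernel-verified Lean document; each statement's English description precedes it below -/
import Mathlib

section
/- Suppose given triangle functors i : T' → T with adjoints i_λ, i_ρ (so (i_λ, i) and (i, i_ρ) are adjoint pairs) and j : T → T'' with adjoints j_λ, j_ρ (so (j_λ, j) and (j, j_ρ) are adjoint pairs), where i, j_λ, j_ρ are fully faithful. If j ∘ i ≅ 0 and the thick subcategory generated by Im(i) ∪ Im(j_λ) equals T, then Im(i) = Ker(j), i.e., the diagram is a recollement. -/
open CategoryTheory CategoryTheory.Limits CategoryTheory.Pretriangulated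

variable (T : Type*) [Category T] [Preadditive T] [HasZeroObject T]
  [HasShift T ℤ] [∀ n : ℤ, (shiftFunctor T n).Additive] [Pretriangulated T]

/-- A predicate on objects of a triangulated category determines a *thick subcategory*
if it is closed under isomorphisms, contains the zero objects, is closed under shifts,
is closed under extensions, and is closed under direct summands (retracts). -/
def IsThickSubcategory (P : T → Prop) : Prop :=
  (∀ (X Y : T), (X ≅ Y) → P X → P Y) ∧
  (∀ (X : T), IsZero X → P X) ∧
  (∀ (X : T) (n : ℤ), P X → P (X⟦n⟧)) ∧
  (∀ (Tr : Triangle T), Tr ∈ (distTriang T) → P Tr.obj₁ → P Tr.obj₃ → P Tr.obj₂) ∧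
  (∀ (X Y : T) (u : X ⟶ Y) (r : Y ⟶ X), u ≫ r = 𝟙 X → P Y → P X)

/-- Given triangle functors `i : T' ⥤ T` with adjoints `(i_λ, i)`, `(i, i_ρ)` and
`j : T ⥤ T''` with adjoints `(j_λ, j)`, `(j, j_ρ)`, where `i`, `j_λ`, `j_ρ` are fully
faithful, if `j ∘ i ≅ 0` and the thick subcategory generated by `Im(i) ∪ Im(j_λ)` is all
of `T`, then `Im(i) = Ker(j)`; that is, the diagram is a recollement. -/
theorem stmt_8 {T' T'' : Type*} [Category T'] [Category T'']
    [Preadditive T'] [HasZeroObject T'] [HasShift T' ℤ]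
    [∀ n : ℤ, (shiftFunctor T' n).Additive] [Pretriangulated T']
    [Preadditive T''] [HasZeroObject T''] [HasShift T'' ℤ]
    [∀ n : ℤ, (shiftFunctor T'' n).Additive] [Pretriangulated T'']
    (i : T' ⥤ T) [i.CommShift ℤ] [i.IsTriangulated] [i.Full] [i.Faithful]
    (il : T ⥤ T') (ir : T ⥤ T') (adj_il : il ⊣ i) (adj_ir : i ⊣ ir)
    (j : T ⥤ T'') [j.CommShift ℤ] [j.IsTriangulated]
    (jl : T'' ⥤ T) (jr : T'' ⥤ T) (adj_jl : jl ⊣ j) (adj_jr : j ⊣ jr)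
    [jl.Full] [jl.Faithful] [jr.Full] [jr.Faithful]
    (hji : ∀ Y : T', IsZero (j.obj (i.obj Y)))
    (hgen : ∀ P : T → Prop, IsThickSubcategory T P →
      (∀ Y : T', P (i.obj Y)) → (∀ Z : T'', P (jl.obj Z)) → ∀ X : T, P X) :
    ∀ X : T, i.essImage X ↔ IsZero (j.obj X) := by
  intro X
  constructor
  · rintro ⟨Y, ⟨e⟩⟩
    exact (hji Y).of_iso (j.mapIso e.symm)
  intro hX
  obtain ⟨ε, hε⟩ : ∃ ε : i.obj (ir.obj X) ⟶ X, ∀ (Y : T') (g : Y ⟶ ir.obj X),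
      (adj_ir.homEquiv Y X).symm g = i.map g ≫ ε :=
    ⟨adj_ir.counit.app X, fun Y g => adj_ir.homEquiv_counit _ _ _⟩
  obtain ⟨W, f, h, hT⟩ := distinguished_cocone_triangle₁ ε
  have hWj : IsZero (j.obj W) :=
    Triangle.isZero₁_of_isZero₂₃ _ (j.map_distinguished _ hT) (hji _) hX
  have surj : ∀ (A : T) (Y : T') (_ : A ≅ i.obj Y) (g : A ⟶ X),
      ∃ g' : A ⟶ i.obj (ir.obj X), g = g' ≫ ε := by
    intro A Y e g
    refine ⟨e.hom ≫ i.map (adj_ir.homEquiv _ _ (e.inv ≫ g)), ?_⟩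
    have := (adj_ir.homEquiv Y X).symm_apply_apply (e.inv ≫ g)
    rw [hε] at this
    rw [Category.assoc, this, e.hom_inv_id_assoc]
  have inj : ∀ (Y : T') (g : i.obj Y ⟶ i.obj (ir.obj X)),
      g ≫ ε = 0 → g = 0 := by
    intro Y g hg
    obtain ⟨k, rfl⟩ := i.map_surjective g
    rw [← hε] at hg
    have h0 : (adj_ir.homEquiv Y X).symm 0 = 0 := by
      rw [hε]; simp
    have := (adj_ir.homEquiv Y X).symm.injective (hg.trans h0.symm)
    rw [this]; simp
  have h1 : ∀ (Y : T') (g : i.obj Y ⟶ W), g = 0 := by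
    intro Y g
    have hfe : f ≫ ε = 0 := comp_distTriang_mor_zero₁₂ _ hT
    have heh : ε ≫ h = 0 := comp_distTriang_mor_zero₂₃ _ hT
    have hgf : g ≫ f = 0 := inj _ _ (by rw [Category.assoc, hfe, comp_zero])
    obtain ⟨k, hk⟩ := Triangle.coyoneda_exact₁ _ hT (g⟦(1 : ℤ)⟧') (by
      change g⟦(1 : ℤ)⟧' ≫ f⟦(1 : ℤ)⟧' = 0
      rw [← Functor.map_comp, hgf, Functor.map_zero])
    change (i.obj Y)⟦(1 : ℤ)⟧ ⟶ X at k
    change g⟦(1 : ℤ)⟧' = k ≫ h at hk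
    obtain ⟨k', rfl⟩ := surj _ _ ((i.commShiftIso (1 : ℤ)).symm.app Y) k
    apply (shiftFunctor T (1 : ℤ)).map_injective
    rw [hk, Category.assoc, heh, comp_zero, Functor.map_zero]
  have key := hgen (fun A => ∀ (n : ℤ) (g : A⟦n⟧ ⟶ W), g = 0) ?_ ?_ ?_
  · have hW : IsZero W := by
      rw [IsZero.iff_id_eq_zero]
      have := key W 0 ((shiftFunctorZero T ℤ).hom.app W)
      rw [← cancel_epi ((shiftFunctorZero T ℤ).hom.app W)]
      simp [this]
    have : IsIso (ε) := (Triangle.isZero₁_iff_isIso₂ _ hT).1 hW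
    exact ⟨_, ⟨asIso (ε)⟩⟩
  · refine ⟨?_, ?_, ?_, ?_, ?_⟩
    · intro A B e hA n g
      have := hA n (e.hom⟦n⟧' ≫ g)
      rw [← cancel_epi (e.hom⟦n⟧'), this, comp_zero]
    · intro A hA n g
      exact ((shiftFunctor T n).map_isZero hA).eq_of_src _ _
    · intro A m hA n g
      have := hA (m + n) ((shiftFunctorAdd T m n).hom.app A ≫ g)
      rw [← cancel_epi ((shiftFunctorAdd T m n).hom.app A), this, comp_zero]
    · intro Tr hTr hA hC n g
      have hS := Triangle.shift_distinguished _ hTr n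
      obtain ⟨k, hk⟩ := Triangle.yoneda_exact₂ _ hS g (hA n _)
      have hk0 : k = 0 := hC n k
      rw [hk0] at hk
      exact hk.trans comp_zero
    · intro A B u r hur hB n g
      have := hB n (r⟦n⟧' ≫ g)
      have h2 : u⟦n⟧' ≫ r⟦n⟧' ≫ g = g := by
        rw [← Category.assoc, ← Functor.map_comp, hur, CategoryTheory.Functor.map_id, Category.id_comp]
      rw [← h2, this, comp_zero]
  · intro Y n g
    have := h1 _ ((i.commShiftIso n).hom.app Y ≫ g)
    rw [← cancel_epi ((i.commShiftIso n).hom.app Y), this, comp_zero]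
  · intro Z n g
    have hz : IsZero (j.obj (W⟦-n⟧)) :=
      ((shiftFunctor T'' (-n)).map_isZero hWj).of_iso ((j.commShiftIso (-n)).app W)
    have hm : ∀ (p : jl.obj Z ⟶ W⟦-n⟧), p = 0 := by
      intro p
      have h0 : ∀ q : jl.obj Z ⟶ W⟦-n⟧, (adj_jl.homEquiv _ _) q = (adj_jl.homEquiv _ _) p :=
        fun q => hz.eq_of_tgt _ _
      exact ((adj_jl.homEquiv _ _).injective (h0 0)).symm
    apply (shiftFunctor T (-n)).map_injective
    have := hm ((shiftFunctorCompIsoId T n (-n) (by simp)).inv.app _ ≫ g⟦-n⟧')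
    rw [← cancel_epi ((shiftFunctorCompIsoId T n (-n) (by simp)).inv.app (jl.obj Z)), this]
    simp
end

section
/- Let L = L(p₁,…,pₙ) be the abelian group generated by x⃗₁,…,x⃗ₙ subject to the relations p₁x⃗₁ = p₂x⃗₂ = ⋯ = pₙx⃗ₙ, where p₁,…,pₙ are positive integers and n ≥ 2. Then every element l⃗ ∈ L can be written uniquely in the normal form l⃗ = Σᵢ lᵢ x⃗ᵢ + l c⃗ with l ∈ ℤ and 0 ≤ lᵢ < pᵢ for each i, where c⃗ = p₁x⃗₁. -/
/-- The subgroup of relations `pᵢ • x⃗ᵢ = pⱼ • x⃗ⱼ` in the free abelian group on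
generators `x⃗₁, …, x⃗ₙ`. -/
def Lrel (n : ℕ) (p : Fin n → ℕ) : AddSubgroup (FreeAbelianGroup (Fin n)) :=
  AddSubgroup.closure
    {g | ∃ i j : Fin n, g = (p i : ℤ) • FreeAbelianGroup.of i -
      (p j : ℤ) • FreeAbelianGroup.of j}

/-- The group `L(p₁, …, pₙ)`: the abelian group generated by `x⃗₁, …, x⃗ₙ` subject to the
relations `p₁x⃗₁ = p₂x⃗₂ = ⋯ = pₙx⃗ₙ`. -/
abbrev Lgrp (n : ℕ) (p : Fin n → ℕ) := FreeAbelianGroup (Fin n) ⧸ Lrel n p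

/-- The generators `x⃗ᵢ` of `L(p₁, …, pₙ)`. -/
def Lgen {n : ℕ} (p : Fin n → ℕ) (i : Fin n) : Lgrp n p :=
  QuotientAddGroup.mk' (Lrel n p) (FreeAbelianGroup.of i)

theorem Lgen_rel {n : ℕ} (p : Fin n → ℕ) (i j : Fin n) :
    (p i : ℤ) • Lgen p i = (p j : ℤ) • Lgen p j := by
  unfold Lgen
  rw [← map_zsmul, ← map_zsmul, ← sub_eq_zero, ← map_sub]
  exact (QuotientAddGroup.eq_zero_iff _).2 (AddSubgroup.subset_closure ⟨i, j, rfl⟩)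

theorem Lgen_hom {n : ℕ} (p : Fin n → ℕ) {A : Type} [AddCommGroup A] (f : Fin n → A)
    (hf : ∀ i j, (p i : ℤ) • f i = (p j : ℤ) • f j) :
    ∃ F : Lgrp n p →+ A, ∀ i, F (Lgen p i) = f i := by
  refine ⟨QuotientAddGroup.lift (Lrel n p) (FreeAbelianGroup.lift f) ?_, ?_⟩
  · unfold Lrel
    rw [AddSubgroup.closure_le]
    rintro _ ⟨i, j, rfl⟩
    simp only [SetLike.mem_coe, AddMonoidHom.mem_ker, map_sub, map_zsmul,
      FreeAbelianGroup.lift_apply_of, hf i j, sub_self]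
  · intro i
    exact FreeAbelianGroup.lift_apply_of f i

theorem Lgen_span {n : ℕ} (p : Fin n → ℕ) (l : Lgrp n p) :
    ∃ a : Fin n → ℤ, l = ∑ i, a i • Lgen p i := by
  obtain ⟨g, rfl⟩ := QuotientAddGroup.mk'_surjective _ l
  induction g using FreeAbelianGroup.induction_on with
  | zero => exact ⟨0, by simp⟩
  | of i => 
    refine ⟨Pi.single i 1, ?_⟩
    rw [Finset.sum_eq_single i]
    · simp [Lgen]
    · intro j _ hj
      simp [hj]
    · simp
  | neg i h =>
    obtain ⟨a, ha⟩ := h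
    refine ⟨-a, ?_⟩
    rw [map_neg, ha]
    simp
  | add x y hx hy =>
    obtain ⟨a, ha⟩ := hx
    obtain ⟨b, hb⟩ := hy
    refine ⟨a + b, ?_⟩
    rw [map_add, ha, hb]
    simp [add_smul, Finset.sum_add_distrib]

/-- Every element of `L(p₁,…,pₙ)` (with all `pᵢ ≥ 1`, `n ≥ 2`) has a unique normal form
`l⃗ = Σᵢ lᵢ x⃗ᵢ + l c⃗` with `l ∈ ℤ` and `0 ≤ lᵢ < pᵢ`, where `c⃗ = p₁x⃗₁` is the canonical
element. -/
theorem stmt_11 (n : ℕ) [NeZero n] (hn : 2 ≤ n) (p : Fin n → ℕ) (hp : ∀ i, 0 < p i)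
    (c : Lgrp n p) (hc : c = (p 0 : ℤ) • Lgen p 0) :
    ∀ l : Lgrp n p, ∃! d : (Fin n → ℕ) × ℤ,
      (∀ i, d.1 i < p i) ∧ l = (∑ i, (d.1 i : ℤ) • Lgen p i) + d.2 • c := by
  intro l
  have hcj : ∀ i, (p i : ℤ) • Lgen p i = c := fun i => by rw [hc, Lgen_rel p i 0]
  obtain ⟨a, rfl⟩ := Lgen_span p l
  refine existsUnique_of_exists_of_unique ?_ ?_
  · refine ⟨(fun i => (a i % p i).toNat, ∑ i, a i / p i), ?_, ?_⟩
    · intro i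
      have h0 : (0 : ℤ) < p i := by exact_mod_cast hp i
      have h1 := Int.emod_nonneg (a i) h0.ne'
      have h2 := Int.emod_lt_of_pos (a i) h0
      show (a i % p i).toNat < p i
      omega
    · simp only
      rw [Finset.sum_smul, ← Finset.sum_add_distrib]
      refine Finset.sum_congr rfl fun i _ => ?_
      have h0 : (0 : ℤ) < p i := by exact_mod_cast hp i
      rw [Int.toNat_of_nonneg (Int.emod_nonneg (a i) h0.ne'), ← hcj i, smul_smul, ← add_smul,
        mul_comm, Int.emod_add_mul_ediv]
  · rintro ⟨d, m⟩ ⟨e, k⟩ ⟨hd, h1⟩ ⟨he, h2⟩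
    rw [h1] at h2
    simp only at hd he h2
    have hde : d = e := by
      funext i
      obtain ⟨F, hF⟩ := Lgen_hom p (A := ZMod (p i)) (fun j => if j = i then 1 else 0) (by
        have : ∀ j, (p j : ℤ) • (if j = i then (1 : ZMod (p i)) else 0) = 0 := by
          intro j
          split_ifs with h
          · subst h; simp
          · simp
        intro j k
        rw [this, this])
      have hFc : F c = 0 := by
        rw [← hcj i, map_zsmul, hF]; simp
      have h3 := congrArg F h2
      simp [map_sum, map_add, map_zsmul, hF, hFc] at h3
      rw [ZMod.natCast_eq_natCast_iff'] at h3
      rwa [Nat.mod_eq_of_lt (hd i), Nat.mod_eq_of_lt (he i)] at h3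
    subst hde
    have h4 := add_left_cancel h2
    have hne : ∀ i, (p i : ℚ) ≠ 0 := fun i => by exact_mod_cast (hp i).ne'
    obtain ⟨F, hF⟩ := Lgen_hom p (A := ℚ) (fun j => 1 / (p j : ℚ)) (by
      intro i j
      simp [hne])
    have hFc : F c = 1 := by
      rw [hc, map_zsmul, hF]; simp [hne]
    have h5 := congrArg F h4
    rw [map_zsmul, map_zsmul, hFc] at h5
    simp at h5
    rw [h5]
end

section
/- A finitely generated L-graded S-module M over the homogeneous coordinate algebra S of a weighted projective line is finitely generated if and only if all the induced graded k[u,v]-modules M|_{l⃗ + ℤc⃗}, for l⃗ ∈ L, are finitely generated k[u,v]-modules. -/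
open MvPolynomial

noncomputable section

variable (k : Type*) [Field k] (n : ℕ) [NeZero n] (p : Fin n → ℕ) (lam : Fin n → k × k)

/-- The canonical element `c⃗ = p₁x⃗₁`. -/
def Lcan : Lgrp n p := (p 0 : ℤ) • Lgen p 0

/-- The defining relations `Xᵢ^{pᵢ} + λᵢ₁ U − λᵢ₀ V`; variables indexed by
`Sum (Fin 2) (Fin n)` with `inl 0 = U`, `inl 1 = V`, `inr i = Xᵢ`. -/
def wplRel (i : Fin n) : MvPolynomial (Sum (Fin 2) (Fin n)) k :=
  X (Sum.inr i) ^ (p i) + C (lam i).2 * X (Sum.inl 0) - C (lam i).1 * X (Sum.inl 1)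

/-- The homogeneous coordinate algebra `S`. -/
def wplS : Type _ :=
  MvPolynomial (Sum (Fin 2) (Fin n)) k ⧸ Ideal.span (Set.range (wplRel k n p lam))

instance : CommRing (wplS k n p lam) := Ideal.Quotient.commRing _
instance : Algebra k (wplS k n p lam) := Ideal.Quotient.algebra k

def wplU : wplS k n p lam := Ideal.Quotient.mk _ (X (Sum.inl 0))
def wplV : wplS k n p lam := Ideal.Quotient.mk _ (X (Sum.inl 1))

/-- The core homomorphism `k[u,v] ⟶ S`. -/
def coreHom : MvPolynomial (Fin 2) k →+* wplS k n p lam :=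
  (MvPolynomial.eval₂Hom (algebraMap k (wplS k n p lam))
    (fun j : Fin 2 => if j = 0 then wplU k n p lam else wplV k n p lam))

/-- The degrees of the variables: `deg u = deg v = c⃗` and `deg xᵢ = x⃗ᵢ`. -/
def wplWeight : Sum (Fin 2) (Fin n) → Lgrp n p :=
  Sum.elim (fun _ => Lcan n p) (fun i => Lgen p i)

/-- The `L`-degree of a monomial. -/
def degMon (e : Sum (Fin 2) (Fin n) →₀ ℕ) : Lgrp n p :=
  e.sum (fun s m => (m : ℤ) • wplWeight n p s)

/-- An element of `S` is homogeneous of degree `d` if it is the image of a polynomial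
all of whose monomials have `L`-degree `d`. -/
def IsHomogeneousElem (s : wplS k n p lam) (d : Lgrp n p) : Prop :=
  ∃ P : MvPolynomial (Sum (Fin 2) (Fin n)) k,
    Ideal.Quotient.mk _ P = s ∧ ∀ e ∈ P.support, degMon n p e = d

variable {M : Type*} [AddCommGroup M] [Module (wplS k n p lam) M]

/-- An `L`-grading on an `S`-module `M`: a family of additive subgroups `ℳ l` forming an
internal direct sum decomposition of `M`, compatible with the `L`-grading of `S`. -/
def IsLGrading (ℳ : Lgrp n p → AddSubgroup M) : Prop :=
  letI := Classical.decEq (Lgrp n p)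
  DirectSum.IsInternal ℳ ∧
  ∀ (d l : Lgrp n p) (s : wplS k n p lam), IsHomogeneousElem k n p lam s d →
    ∀ m ∈ ℳ l, s • m ∈ ℳ (d + l)

/-- The restriction `M|_{l⃗+ℤc⃗} = ⊕_{l⃗' ∈ l⃗+ℤc⃗} M_{l⃗'}`, as a `k[u,v]`-submodule of
`M`, where `M` is regarded as a `k[u,v]`-module via the core homomorphism. -/
def restrictCore (ℳ : Lgrp n p → AddSubgroup M) (l : Lgrp n p) :
    @Submodule (MvPolynomial (Fin 2) k) M _ _
      (Module.compHom M (coreHom k n p lam)) :=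
  letI : Module (MvPolynomial (Fin 2) k) M := Module.compHom M (coreHom k n p lam)
  Submodule.span _ (⋃ m : ℤ, ((ℳ (l + m • Lcan n p) : AddSubgroup M) : Set M))

theorem my_mul_smul {R N : Type*} [CommRing R] [AddCommGroup N] [Module R N] (a b : R) (x : N) :
    (a * b) • x = a • (b • x) := mul_smul a b x

theorem core_U : coreHom k n p lam (X 0) = wplU k n p lam := by
  simp [coreHom]

theorem core_V : coreHom k n p lam (X 1) = wplV k n p lam := by
  simp [coreHom]

theorem core_C (a : k) : coreHom k n p lam (C a) = algebraMap k (wplS k n p lam) a := by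
  simp [coreHom]

/-- The quotient map onto `S`. -/
def wplMk : MvPolynomial (Sum (Fin 2) (Fin n)) k →+* wplS k n p lam :=
  Ideal.Quotient.mk _

theorem wplMk_surj : Function.Surjective (wplMk k n p lam) := Ideal.Quotient.mk_surjective

theorem wplMk_C (a : k) : wplMk k n p lam (C a) = algebraMap k (wplS k n p lam) a := rfl

theorem wplMk_rel (i : Fin n) : wplMk k n p lam (X (Sum.inr i)) ^ (p i) =
    coreHom k n p lam (C (lam i).1 * X 1 - C (lam i).2 * X 0) := by
  have h : wplMk k n p lam (wplRel k n p lam i) = 0 :=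
    Ideal.Quotient.eq_zero_iff_mem.mpr (Ideal.subset_span ⟨i, rfl⟩)
  have hu : wplMk k n p lam (X (Sum.inl 0)) = wplU k n p lam := rfl
  have hv : wplMk k n p lam (X (Sum.inl 1)) = wplV k n p lam := rfl
  simp only [wplRel, map_sub, map_add, map_mul, map_pow, wplMk_C, hu, hv] at h
  simp only [map_sub, map_mul, core_C, core_U, core_V]
  linear_combination h

theorem core_finite (hp : ∀ i, 0 < p i) : (coreHom k n p lam).Finite := by
  apply RingHom.IsIntegral.to_finite
  · intro s
    obtain ⟨P, rfl⟩ := wplMk_surj k n p lam s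
    induction P using MvPolynomial.induction_on with
    | C a =>
      rw [wplMk_C, ← core_C]
      exact RingHom.isIntegralElem_map _
    | add P Q hP hQ => rw [map_add]; exact hP.add _ hQ
    | mul_X P i hP =>
      rw [map_mul]
      refine hP.mul _ ?_
      rcases i with j | i
      · fin_cases j
        · have := (coreHom k n p lam).isIntegralElem_map (x := X 0)
          rw [core_U] at this; exact this
        · have := (coreHom k n p lam).isIntegralElem_map (x := X 1)
          rw [core_V] at this; exact this
      · letI := (coreHom k n p lam).toAlgebra
        have h := (coreHom k n p lam).isIntegralElem_map
          (x := C (lam i).1 * X 1 - C (lam i).2 * X 0)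
        rw [← wplMk_rel] at h
        exact IsIntegral.of_pow (R := MvPolynomial (Fin 2) k) (hp i) h
  · have h : (algebraMap k (wplS k n p lam)).FiniteType := by
      have h1 : (C : k →+* MvPolynomial (Sum (Fin 2) (Fin n)) k).FiniteType := by
        have : Algebra.FiniteType k (MvPolynomial (Sum (Fin 2) (Fin n)) k) := inferInstance
        exact (RingHom.finiteType_algebraMap (A := k)).mpr this
      exact RingHom.FiniteType.comp_surjective (g := wplMk k n p lam) h1 (wplMk_surj k n p lam)
    apply RingHom.FiniteType.of_comp_finiteType (f := (C : k →+* MvPolynomial (Fin 2) k))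
    convert h
    ext a
    exact core_C k n p lam a

theorem Lgen_smul (i : Fin n) : (p i : ℤ) • Lgen p i = Lcan n p := by
  rw [Lcan, Lgen, Lgen, ← map_zsmul, ← map_zsmul]
  rw [← sub_eq_zero, ← map_sub]
  exact (QuotientAddGroup.eq_zero_iff _).mpr (AddSubgroup.subset_closure ⟨i, 0, rfl⟩)

theorem L_repr (l : Lgrp n p) : ∃ z : Fin n → ℤ, l = ∑ i, z i • Lgen p i := by
  obtain ⟨g, rfl⟩ := QuotientAddGroup.mk'_surjective (Lrel n p) l
  induction g using FreeAbelianGroup.induction_on with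
  | zero => exact ⟨0, by simp⟩
  | of i =>
    refine ⟨Pi.single i 1, ?_⟩
    rw [Finset.sum_eq_single i]
    · simp [Lgen]
    · intro j _ hj; simp [hj]
    · simp
  | neg i h =>
    obtain ⟨z, hz⟩ := h
    exact ⟨-z, by simp only [map_neg, hz, Pi.neg_apply, neg_smul, Finset.sum_neg_distrib]⟩
  | add x y hx hy =>
    obtain ⟨z, hz⟩ := hx
    obtain ⟨w, hw⟩ := hy
    exact ⟨z + w, by simp only [map_add, hz, hw, Pi.add_apply, add_smul, Finset.sum_add_distrib]⟩

theorem L_fin (hp : ∀ i, 0 < p i) (l : Lgrp n p) :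
    ∃ (a : (i : Fin n) → Fin (p i)) (m : ℤ),
      l = (∑ i, ((a i : ℕ) : ℤ) • Lgen p i) + m • Lcan n p := by
  obtain ⟨z, rfl⟩ := L_repr n p l
  have hpos : ∀ i, (0 : ℤ) < p i := fun i => by exact_mod_cast hp i
  refine ⟨fun i => ⟨(z i % p i).toNat, ?_⟩, ∑ i, z i / p i, ?_⟩
  · have h1 := Int.emod_nonneg (z i) (hpos i).ne'
    have h2 := Int.emod_lt_of_pos (z i) (hpos i)
    omega
  · rw [Finset.sum_smul, ← Finset.sum_add_distrib]
    refine Finset.sum_congr rfl fun i _ => ?_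
    rw [← Lgen_smul n p i, smul_smul, ← add_smul]
    congr 1
    have h1 := Int.emod_nonneg (z i) (hpos i).ne'
    simp only [Int.toNat_of_nonneg h1]
    rw [mul_comm, Int.emod_add_mul_ediv]

/-- An `L`-graded `S`-module `M` is finitely generated if and only if all the restricted
graded `k[u,v]`-modules `M|_{l⃗+ℤc⃗}`, `l⃗ ∈ L`, are finitely generated. -/
theorem stmt_16 (hp : ∀ i, 0 < p i)
    (hnz : ∀ i, lam i ≠ (0, 0))
    (hdist : ∀ i j, i ≠ j → (lam i).1 * (lam j).2 ≠ (lam i).2 * (lam j).1)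
    (ℳ : Lgrp n p → AddSubgroup M) (hgr : IsLGrading k n p lam ℳ) :
    Module.Finite (wplS k n p lam) M ↔
      ∀ l : Lgrp n p,
        @Submodule.FG (MvPolynomial (Fin 2) k) M _ _
          (Module.compHom M (coreHom k n p lam))
          (restrictCore k n p lam ℳ l) := by
  letI : Module (MvPolynomial (Fin 2) k) M := Module.compHom M (coreHom k n p lam)
  letI : Algebra (MvPolynomial (Fin 2) k) (wplS k n p lam) := (coreHom k n p lam).toAlgebra
  haveI : IsScalarTower (MvPolynomial (Fin 2) k) (wplS k n p lam) M :=
    ⟨fun a s m => my_mul_smul (coreHom k n p lam a) s m⟩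
  haveI : Module.Finite (MvPolynomial (Fin 2) k) (wplS k n p lam) := core_finite k n p lam hp
  constructor
  · intro h l
    haveI : Module.Finite (MvPolynomial (Fin 2) k) M := Module.Finite.trans (wplS k n p lam) M
    exact IsNoetherian.noetherian (restrictCore k n p lam ℳ l)
  · intro h
    have htop : (⨆ a : (i : Fin n) → Fin (p i),
        restrictCore k n p lam ℳ (∑ i, ((a i : ℕ) : ℤ) • Lgen p i)) = ⊤ := by
      rw [eq_top_iff]
      intro x _
      letI := Classical.decEq (Lgrp n p)
      obtain ⟨y, rfl⟩ := hgr.1.2 x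
      induction y using DirectSum.induction_on with
      | zero => rw [map_zero]; exact Submodule.zero_mem _
      | of l m =>
        rw [DirectSum.coeAddMonoidHom_of]
        obtain ⟨a, t, hl⟩ := L_fin n p hp l
        refine Submodule.mem_iSup_of_mem a (Submodule.subset_span (Set.mem_iUnion.mpr ⟨t, ?_⟩))
        rw [← hl]
        exact m.2
      | add x y hx hy => rw [map_add]; exact Submodule.add_mem _ (hx trivial) (hy trivial)
    haveI : Module.Finite (MvPolynomial (Fin 2) k) M :=
      ⟨htop ▸ Submodule.fg_iSup _ fun a => h _⟩
    exact Module.Finite.of_restrictScalars_finite (MvPolynomial (Fin 2) k) (wplS k n p lam) M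


end
end
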